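/- Let G = G_{m,n} be the m × n grid graph (m, n ≥ 1). Then hn_cc(G) = m + n − 1. -/

import Mathlib

open SimpleGraph

/-- The cycle-convexity interval function: `Icc G S` adds to `S` every vertex `v`
lying on a cycle of the subgraph of `G` induced by `S ∪ {v}`. -/
def Icc {V : Type*} (G : SimpleGraph V) (S : Set V) : Set V :=
  S ∪ {v | ∃ w : (G.induce (insert v S)).Walk ⟨v, Set.mem_insert v S⟩ ⟨v, Set.mem_insert v S⟩,
        w.IsCycle}

/-- A set is convex in the cycle convexity if it is `Icc`-closed. -/
def CcConvex {V : Type*} (G : SimpleGraph V) (S : Set V) : Prop := Icc G S = S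

/-- The convex hull of `S` in the cycle convexity: the smallest convex set containing `S`. -/
def ccHull {V : Type*} (G : SimpleGraph V) (S : Set V) : Set V :=
  ⋂₀ {T : Set V | S ⊆ T ∧ CcConvex G T}

/-- A hull set in the cycle convexity. -/
def IsHullSet {V : Type*} (G : SimpleGraph V) (S : Set V) : Prop := ccHull G S = Set.univ

/-- The hull number in the cycle convexity: minimum cardinality of a hull set. -/
noncomputable def hnCC {V : Type*} (G : SimpleGraph V) : ℕ :=
  sInf {n | ∃ S : Set V, S.ncard = n ∧ IsHullSet G S}


/-- The `m × n` grid graph: vertices are pairs `(i, j)` with `i < m`, `j < n`, and two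
vertices are adjacent iff their coordinates are at `ℓ₁`-distance one. -/
def gridGraph (m n : ℕ) : SimpleGraph (Fin m × Fin n) :=
  SimpleGraph.fromRel (fun p q => Nat.dist p.1.val q.1.val + Nat.dist p.2.val q.2.val = 1)

theorem subset_ccHull {V : Type*} (G : SimpleGraph V) (S : Set V) : S ⊆ ccHull G S :=
  Set.subset_sInter fun _ hT => hT.1

theorem ccHull_mono {V : Type*} (G : SimpleGraph V) {S T : Set V} (h : S ⊆ T) :
    ccHull G S ⊆ ccHull G T :=
  Set.subset_sInter fun _ hU => Set.sInter_subset_of_mem ⟨h.trans hU.1, hU.2⟩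

theorem CcConvex.ccHull_eq {V : Type*} {G : SimpleGraph V} {S : Set V} (h : CcConvex G S) :
    ccHull G S = S :=
  Set.Subset.antisymm (Set.sInter_subset_of_mem ⟨subset_rfl, h⟩) (subset_ccHull G S)

theorem IsHullSet.mono {V : Type*} {G : SimpleGraph V} {S T : Set V} (hS : IsHullSet G S)
    (h : S ⊆ T) : IsHullSet G T :=
  Set.eq_univ_of_univ_subset (hS.symm.subset.trans (ccHull_mono G h))

theorem IsHullSet.exists_isCycle {V : Type*} {G : SimpleGraph V} {S : Set V}
    (hS : IsHullSet G S) (h : S ≠ Set.univ) :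
    ∃ v ∉ S, ∃ w : (G.induce (insert v S)).Walk
      ⟨v, Set.mem_insert v S⟩ ⟨v, Set.mem_insert v S⟩, w.IsCycle := by
  by_contra! hc
  have hconv : CcConvex G S := by
    refine Set.Subset.antisymm ?_ Set.subset_union_left
    rintro v (hv | ⟨w, hw⟩)
    · exact hv
    · by_contra hv
      exact hc v hv w hw
  exact h (hconv.ccHull_eq.symm.trans hS)

/-- If `S` is a hull set of a connected graph, deleting one edge for each vertex outside `S`,
none of them inside `S`, can be done while keeping the graph connected. -/
theorem IsHullSet.exists_connected_subgraph {V : Type*} [Finite V] {G : SimpleGraph V}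
    (hG : G.Connected) {S : Set V} (hS : IsHullSet G S) :
    ∃ H : SimpleGraph V, H.Connected ∧ (∀ u ∈ S, ∀ v ∈ S, G.Adj u v → H.Adj u v) ∧
      H.edgeSet.ncard + Sᶜ.ncard ≤ G.edgeSet.ncard := by
  induction hk : Sᶜ.ncard generalizing S with
  | zero => exact ⟨G, hG, fun _ _ _ _ h => h, le_rfl⟩
  | succ k ih =>
    obtain ⟨v, hv, w, hw⟩ := hS.exists_isCycle (by rintro rfl; simp at hk)
    have hcard : (insert v S)ᶜ.ncard = k := by
      have : (insert v S)ᶜ = Sᶜ \ {v} := by ext x; simp [not_or, and_comm]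
      rw [this, Set.ncard_sdiff_singleton_of_mem hv, hk, Nat.add_sub_cancel]
    obtain ⟨H, hH, hle, hE⟩ := ih (hS.mono (Set.subset_insert v S)) hcard
    let f : G.induce (insert v S) →g H := ⟨Subtype.val, fun {a b} hab => hle a a.2 b b.2 hab⟩
    have hc : (w.map f).IsCycle := hw.map Subtype.val_injective
    have hmem := Walk.mk_start_snd_mem_edges hc.not_nil
    have hbr := fun h : H.IsBridge _ => h.notMem_edges_of_isCycle hc hmem
    refine ⟨_, hH.connected_delete_edge_of_not_isBridge hbr, fun a ha b hb hab => ?_, ?_⟩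
    · refine (deleteEdges_adj ..).2 ⟨hle a (.inr ha) b (.inr hb) hab, fun h => ?_⟩
      have : v ∈ s(a, b) := h ▸ Sym2.mem_mk_left _ _
      rcases Sym2.mem_iff.1 this with rfl | rfl
      · exact hv ha
      · exact hv hb
    · rw [edgeSet_deleteEdges]
      have := Set.ncard_sdiff_singleton_add_one (Walk.edges_subset_edgeSet _ hmem)
      omega

/-- A hull set is at least as large as the number of vertices minus the cyclomatic number. -/
theorem IsHullSet.two_mul_card_le {V : Type*} [Finite V] {G : SimpleGraph V}
    (hG : G.Connected) {S : Set V} (hS : IsHullSet G S) :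
    2 * Nat.card V ≤ S.ncard + G.edgeSet.ncard + 1 := by
  obtain ⟨H, hH, -, hE⟩ := hS.exists_connected_subgraph hG
  have h := hH.card_vert_le_card_edgeSet_add_one
  rw [Nat.card_coe_set_eq] at h
  have := Set.ncard_add_ncard_compl S
  omega

theorem gridGraph_eq_boxProd (m n : ℕ) : gridGraph m n = pathGraph m □ pathGraph n := by
  ext ⟨a, b⟩ ⟨c, d⟩
  simp only [gridGraph, fromRel_adj, boxProd_adj, pathGraph_adj, Nat.dist, ne_eq, Prod.mk.injEq,
    Fin.ext_iff]
  omega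

theorem gridGraph_connected (m n : ℕ) : (gridGraph (m + 1) (n + 1)).Connected :=
  gridGraph_eq_boxProd _ _ ▸ (pathGraph_connected m).boxProd (pathGraph_connected n)

theorem ncard_edgeSet_gridGraph_le (m n : ℕ) :
    (gridGraph (m + 1) (n + 1)).edgeSet.ncard ≤ m * (n + 1) + (m + 1) * n := by
  let f : Fin m × Fin (n + 1) ⊕ Fin (m + 1) × Fin n → Sym2 (Fin (m + 1) × Fin (n + 1)) :=
    Sum.elim (fun p => s((p.1.castSucc, p.2), (p.1.succ, p.2)))
      (fun p => s((p.1, p.2.castSucc), (p.1, p.2.succ)))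
  have hsub : (gridGraph (m + 1) (n + 1)).edgeSet ⊆ Set.range f := by
    have key : ∀ {k : ℕ} (a b : Fin (k + 1)), a.val + 1 = b.val →
        ∃ i : Fin k, i.castSucc = a ∧ i.succ = b := fun a b h =>
      ⟨⟨a, by omega⟩, rfl, Fin.ext h⟩
    rintro ⟨⟨a, b⟩, ⟨c, d⟩⟩ h
    change (gridGraph (m + 1) (n + 1)).Adj (a, b) (c, d) at h
    rw [gridGraph_eq_boxProd, boxProd_adj, pathGraph_adj, pathGraph_adj] at h
    rcases h with ⟨h | h, rfl : b = d⟩ | ⟨h | h, rfl : a = c⟩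
    · obtain ⟨i, rfl, rfl⟩ := key _ _ h
      exact ⟨.inl (i, b), rfl⟩
    · obtain ⟨i, rfl, rfl⟩ := key _ _ h
      exact ⟨.inl (i, b), Sym2.eq_swap⟩
    · obtain ⟨i, rfl, rfl⟩ := key _ _ h
      exact ⟨.inr (a, i), rfl⟩
    · obtain ⟨i, rfl, rfl⟩ := key _ _ h
      exact ⟨.inr (a, i), Sym2.eq_swap⟩
  calc _ ≤ (Set.range f).ncard := Set.ncard_le_ncard hsub
    _ ≤ Nat.card (Fin m × Fin (n + 1) ⊕ Fin (m + 1) × Fin n) := by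
      rw [← Set.image_univ, ← Set.ncard_univ]
      exact Set.ncard_image_le
    _ = _ := by simp

theorem isCycle_of_square {V : Type*} {G : SimpleGraph V} {v a b c : V} (hva : G.Adj v a)
    (hab : G.Adj a b) (hbc : G.Adj b c) (hcv : G.Adj c v) (hvb : v ≠ b) (hac : a ≠ c) :
    (Walk.cons hva (.cons hab (.cons hbc (.cons hcv .nil)))).IsCycle := by
  rw [Walk.cons_isCycle_iff]
  simp [Walk.cons_isPath_iff, hva.ne, hva.ne', hab.ne, hbc.ne, hcv.ne, hcv.ne', hvb, hvb.symm, hac]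

theorem mem_Icc_of_square {V : Type*} {G : SimpleGraph V} {S : Set V} {v a b c : V}
    (ha : a ∈ S) (hb : b ∈ S) (hc : c ∈ S) (hva : G.Adj v a) (hab : G.Adj a b)
    (hbc : G.Adj b c) (hcv : G.Adj c v) (hvb : v ≠ b) (hac : a ≠ c) : v ∈ Icc G S := by
  let G' := G.induce (insert v S)
  have h₁ : G'.Adj ⟨v, Set.mem_insert v S⟩ ⟨a, .inr ha⟩ := hva
  have h₂ : G'.Adj ⟨a, .inr ha⟩ ⟨b, .inr hb⟩ := hab
  have h₃ : G'.Adj ⟨b, .inr hb⟩ ⟨c, .inr hc⟩ := hbc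
  have h₄ : G'.Adj ⟨c, .inr hc⟩ ⟨v, Set.mem_insert v S⟩ := hcv
  exact .inr ⟨_, isCycle_of_square h₁ h₂ h₃ h₄ (fun h => hvb (congrArg Subtype.val h))
    (fun h => hac (congrArg Subtype.val h))⟩

theorem gridGraph_isHullSet (m n : ℕ) :
    IsHullSet (gridGraph (m + 1) (n + 1)) {p | p.1 = 0 ∨ p.2 = 0} := by
  refine Set.eq_univ_of_forall fun p => Set.mem_sInter.2 fun T ⟨hS, hT⟩ => ?_
  obtain ⟨i, j⟩ := p
  induction i using Fin.induction generalizing j with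
  | zero => exact hS (.inl rfl)
  | succ i ihi =>
    induction j using Fin.induction with
    | zero => exact hS (.inr rfl)
    | succ j ihj =>
      rw [← hT]
      refine mem_Icc_of_square (ihi j.succ) (ihi j.castSucc) ihj ?_ ?_ ?_ ?_ ?_ ?_ <;>
        simp [gridGraph_eq_boxProd, boxProd_adj, pathGraph_adj, Fin.ext_iff]

theorem ncard_cross (m n : ℕ) :
    {p : Fin (m + 1) × Fin (n + 1) | p.1 = 0 ∨ p.2 = 0}.ncard = m + n + 1 := by
  have h : {p : Fin (m + 1) × Fin (n + 1) | p.1 = 0 ∨ p.2 = 0}ᶜ =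
      Set.range (Prod.map (Fin.succ : Fin m → _) (Fin.succ : Fin n → _)) := by
    ext ⟨i, j⟩
    simp [Set.range_prodMap, Fin.range_succ]
  have h1 := Set.ncard_add_ncard_compl {p : Fin (m + 1) × Fin (n + 1) | p.1 = 0 ∨ p.2 = 0}
  have h2 : (Set.range (Prod.map (Fin.succ : Fin m → _) (Fin.succ : Fin n → _))).ncard =
      m * n := by
    rw [← Set.image_univ, Set.ncard_image_of_injective _
      ((Fin.succ_injective m).prodMap (Fin.succ_injective n))]
    simp [Set.ncard_univ]
  rw [h, h2] at h1
  simp only [Nat.card_eq_fintype_card, Fintype.card_prod, Fintype.card_fin] at h1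
  linarith

/-- The hull number of the `m × n` grid in the cycle convexity is `m + n - 1`. -/
theorem hnCC_grid (m n : ℕ) (hm : 1 ≤ m) (hn : 1 ≤ n) :
    hnCC (gridGraph m n) = m + n - 1 := by
  obtain ⟨m, rfl⟩ := Nat.exists_eq_add_of_le' hm
  obtain ⟨n, rfl⟩ := Nat.exists_eq_add_of_le' hn
  have hmem : m + n + 1 ∈ {k | ∃ S : Set (Fin (m + 1) × Fin (n + 1)),
      S.ncard = k ∧ IsHullSet (gridGraph (m + 1) (n + 1)) S} :=
    ⟨_, ncard_cross m n, gridGraph_isHullSet m n⟩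
  have heq : m + 1 + (n + 1) - 1 = m + n + 1 := by omega
  rw [heq]
  refine le_antisymm (Nat.sInf_le hmem) (le_csInf ⟨_, hmem⟩ ?_)
  rintro _ ⟨S, rfl, hS⟩
  have h1 := hS.two_mul_card_le (gridGraph_connected m n)
  have h2 := ncard_edgeSet_gridGraph_le m n
  simp only [Nat.card_eq_fintype_card, Fintype.card_prod, Fintype.card_fin] at h1
  linarith
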